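/- arXiv:1603.04333 — 4 statements merged into one kernel-verified Lean document; each statement's English description precedes it below -/
import Mathlib

section
/- Let G = (V, E) be a finite simple graph, q ≥ 2 an integer, β ≥ 0 and h = e^β − 1. Then the high-temperature expansion of the Potts partition function holds: Z_P(β, q, G) = ((q + h)/q)^{|E|} · Σ_{A ⊆ E : no vertex of V has degree 1 in (V, A)} (h/(q + h))^{|A|} · Σ_{σ : V → {1, …, q}} Π_{{i,j} ∈ A} (q·δ_{σ(i), σ(j)} − 1). -/
open Classical

/-- Kronecker delta `δ_{σ(i),σ(j)}` for an edge `e = {i,j}`. -/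
noncomputable def edgeDelta {V : Type} {q : ℕ} (σ : V → Fin q) (e : Sym2 V) : ℝ :=
  if ∀ i ∈ e, ∀ j ∈ e, σ i = σ j then 1 else 0

/-- The q-state Potts partition function on a finite simple graph. -/
noncomputable def pottsZ {V : Type} [Fintype V] [DecidableEq V]
    (G : SimpleGraph V) [DecidableRel G.Adj] (β : ℝ) (q : ℕ) : ℝ :=
  ∑ σ : V → Fin q, Real.exp (β * ∑ e ∈ G.edgeFinset, edgeDelta σ e)

/-- The degree of the vertex `v` in the spanning subgraph `(V, A)`: the number of
edges of `A` incident to `v`. -/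
noncomputable def degIn {V : Type} [DecidableEq V] (A : Finset (Sym2 V)) (v : V) : ℕ :=
  (A.filter (fun e => v ∈ e)).card

/-- A sum over all colourings vanishes if it vanishes when recolouring a single vertex. -/
theorem sum_eq_zero_of_sum_update_eq_zero {ι α M : Type*} [Fintype ι] [DecidableEq ι]
    [Fintype α] [AddCommMonoid M] (f : (ι → α) → M) (v : ι)
    (hf : ∀ σ, ∑ c, f (Function.update σ v c) = 0) : ∑ σ, f σ = 0 := by
  rw [← (Equiv.funSplitAt v α).symm.sum_comp, Fintype.sum_prod_type, Finset.sum_comm]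
  refine Finset.sum_eq_zero fun τ _ => ?_
  cases isEmpty_or_nonempty α with
  | inl _ => simp
  | inr hα =>
    obtain ⟨a⟩ := hα
    rw [← hf ((Equiv.funSplitAt v α).symm (a, τ))]
    refine Finset.sum_congr rfl fun c _ => congrArg f ?_
    ext j
    by_cases hj : j = v
    · subst hj; simp [Equiv.funSplitAt]
    · simp [Equiv.funSplitAt, hj]

theorem edgeDelta_mk {V : Type} {q : ℕ} (σ : V → Fin q) (v w : V) :
    edgeDelta σ s(v, w) = if σ v = σ w then 1 else 0 := by
  unfold edgeDelta
  congr 1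
  simp only [Sym2.mem_iff, forall_eq_or_imp, forall_eq, eq_iff_iff]
  grind

theorem edgeDelta_update_of_notMem {V : Type} [DecidableEq V] {q : ℕ} (σ : V → Fin q) {v : V}
    {e : Sym2 V} (hv : v ∉ e) (c : Fin q) :
    edgeDelta (Function.update σ v c) e = edgeDelta σ e := by
  unfold edgeDelta
  congr 1
  refine propext (forall₂_congr fun i hi => forall₂_congr fun j hj => ?_)
  rw [Function.update_of_ne (ne_of_mem_of_not_mem hi hv),
    Function.update_of_ne (ne_of_mem_of_not_mem hj hv)]

theorem exp_mul_edgeDelta {V : Type} {q : ℕ} (hq : q ≠ 0) {β h : ℝ} (hh : h = Real.exp β - 1)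
    (hqh : (q : ℝ) + h ≠ 0) (σ : V → Fin q) (e : Sym2 V) :
    Real.exp (β * edgeDelta σ e) =
      ((q : ℝ) + h) / q * (h / ((q : ℝ) + h) * ((q : ℝ) * edgeDelta σ e - 1) + 1) := by
  have hq' : (q : ℝ) ≠ 0 := Nat.cast_ne_zero.mpr hq
  have hexp : Real.exp β = h + 1 := by rw [hh]; ring
  unfold edgeDelta
  split_ifs
  · rw [mul_one, hexp]
    field_simp
    ring
  · rw [mul_zero, Real.exp_zero]
    field_simp
    ring

/-- Edge sets without loops having a vertex of degree one do not contribute to the expansion. -/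
theorem sum_prod_edgeDelta_eq_zero {V : Type} [Fintype V] [DecidableEq V] {q : ℕ}
    {A : Finset (Sym2 V)} (hA : ∀ e ∈ A, ¬ e.IsDiag) {v : V} (hv : degIn A v = 1) :
    ∑ σ : V → Fin q, ∏ e ∈ A, ((q : ℝ) * edgeDelta σ e - 1) = 0 := by
  obtain ⟨e₀, he₀⟩ := Finset.card_eq_one.mp hv
  have hmem : e₀ ∈ A ∧ v ∈ e₀ := by
    have := Finset.mem_singleton_self e₀
    rwa [← he₀, Finset.mem_filter] at this
  obtain ⟨heA, w, rfl⟩ := hmem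
  have hvw : w ≠ v := fun hwv => hA _ heA (by simp [hwv])
  refine sum_eq_zero_of_sum_update_eq_zero _ v fun σ => ?_
  have hrest : ∀ c, ∏ e ∈ A.erase s(v, w),
      ((q : ℝ) * edgeDelta (Function.update σ v c) e - 1) =
        ∏ e ∈ A.erase s(v, w), ((q : ℝ) * edgeDelta σ e - 1) := fun c => by
    refine Finset.prod_congr rfl fun e he => ?_
    rw [edgeDelta_update_of_notMem]
    intro hve
    refine (Finset.mem_erase.mp he).1 (Finset.mem_singleton.mp ?_)
    rw [← he₀]
    exact Finset.mem_filter.mpr ⟨(Finset.mem_erase.mp he).2, hve⟩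
  simp_rw [← Finset.mul_prod_erase A _ heA, hrest, ← Finset.sum_mul, edgeDelta_mk,
    Function.update_self, Function.update_of_ne hvw]
  simp

/-- High-temperature expansion of the Potts partition function, restricted to edge
subsets with no vertex of degree one, with `h = e^β − 1`. -/
theorem potts_high_temperature_expansion
    {V : Type} [Fintype V] [DecidableEq V] (G : SimpleGraph V) [DecidableRel G.Adj]
    (q : ℕ) (hq : 2 ≤ q) (β : ℝ) (hβ : 0 ≤ β) (h : ℝ) (hh : h = Real.exp β - 1) :
    pottsZ G β q =
      (((q : ℝ) + h) / q) ^ G.edgeFinset.card *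
        ∑ A ∈ G.edgeFinset.powerset.filter (fun A => ∀ v : V, degIn A v ≠ 1),
          (h / ((q : ℝ) + h)) ^ A.card *
            ∑ σ : V → Fin q, ∏ e ∈ A, ((q : ℝ) * edgeDelta σ e - 1) := by
  have hqh : (q : ℝ) + h ≠ 0 := by
    have h₂ : (2 : ℝ) ≤ q := by exact_mod_cast hq
    have := Real.add_one_le_exp β
    linarith
  have hdeg : ∀ A ∈ G.edgeFinset.powerset,
      (h / ((q : ℝ) + h)) ^ A.card *
        ∑ σ : V → Fin q, ∏ e ∈ A, ((q : ℝ) * edgeDelta σ e - 1) ≠ 0 →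
      ∀ v : V, degIn A v ≠ 1 := fun A hA hne v hv =>
    hne (by
      rw [sum_prod_edgeDelta_eq_zero (fun e he => G.not_isDiag_of_mem_edgeFinset
        (Finset.mem_powerset.mp hA he)) hv, mul_zero])
  rw [Finset.sum_filter_of_ne hdeg]
  simp_rw [pottsZ, Finset.mul_sum, Real.exp_sum, exp_mul_edgeDelta (by omega : q ≠ 0) hh hqh,
    Finset.prod_mul_distrib, Finset.prod_const, Finset.prod_add_one, Finset.prod_mul_distrib,
    Finset.prod_const, Finset.mul_sum]
  exact Finset.sum_comm
end

section
/- Let G = (V, E) be a finite simple graph, q ≥ 2 an integer, and A ⊆ E a set of edges such that every subset S ⊆ A satisfies the cycle-rank bound ξ(S) ≤ (2/3)(|S| + 1). Then for every integer k with 0 ≤ k ≤ |A|: Σ_{S ⊆ A, |S| = k} Σ_{σ : V → {1, …, q}} Π_{{i,j} ∈ S} δ_{σ(i), σ(j)} ≤ binom(|A|, k) · q^{|V| − k/3 + 2/3}. -/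
open Classical

/-- Number of connected components (isolated vertices included) of the spanning
subgraph `(V, S)`. -/
noncomputable def numClusters {V : Type} [Fintype V] (S : Finset (Sym2 V)) : ℕ :=
  Nat.card (SimpleGraph.fromEdgeSet (↑S : Set (Sym2 V))).ConnectedComponent

/-- Cycle rank (number of independent circuits) `ξ(S) = |S| − |V| + k(S)` of the
spanning subgraph `(V, S)`, as a real number. -/
noncomputable def cycleRank {V : Type} [Fintype V] (S : Finset (Sym2 V)) : ℝ :=
  (S.card : ℝ) - Fintype.card V + numClusters S

/-- The edge deltas multiply to the indicator of the colourings that are constant on the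
components of `(V, S)`. -/
theorem prod_edgeDelta_eq_ite {V : Type} {q : ℕ} (S : Finset (Sym2 V)) (σ : V → Fin q)
    [Decidable (∃ f : (SimpleGraph.fromEdgeSet (S : Set (Sym2 V))).ConnectedComponent → Fin q,
      (fun v => f (SimpleGraph.connectedComponentMk _ v)) = σ)] :
    ∏ e ∈ S, edgeDelta σ e =
      if ∃ f : (SimpleGraph.fromEdgeSet (S : Set (Sym2 V))).ConnectedComponent → Fin q,
        (fun v => f (SimpleGraph.connectedComponentMk _ v)) = σ then 1 else 0 := by
  unfold edgeDelta
  rw [Finset.prod_ite_zero, Finset.prod_const_one]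
  congr 1
  refine propext ⟨fun h => ?_, ?_⟩
  · have hadj : ∀ v w, (SimpleGraph.fromEdgeSet (S : Set (Sym2 V))).Adj v w → σ v = σ w := by
      intro v w hvw
      rw [SimpleGraph.fromEdgeSet_adj] at hvw
      exact h s(v, w) (by simpa using hvw.1) v (by simp) w (by simp)
    refine ⟨SimpleGraph.ConnectedComponent.lift σ fun v w p _ => ?_, rfl⟩
    induction p with
    | nil => rfl
    | cons hvw _ ih => exact (hadj _ _ hvw).trans (ih (by simp_all))
  · rintro ⟨f, rfl⟩ e he i hi j hj
    by_cases hij : i = j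
    · rw [hij]
    · obtain rfl := (Sym2.mem_and_mem_iff hij).1 ⟨hi, hj⟩
      exact congrArg f (SimpleGraph.ConnectedComponent.connectedComponentMk_eq_of_adj
        ((SimpleGraph.fromEdgeSet_adj _).2 ⟨by simpa using he, hij⟩))

/-- The number of colourings constant on every edge of `S` is `q ^ k(S)`. -/
theorem sum_prod_edgeDelta {V : Type} [Fintype V] [DecidableEq V] (q : ℕ)
    (S : Finset (Sym2 V)) :
    ∑ σ : V → Fin q, ∏ e ∈ S, edgeDelta σ e = (q : ℝ) ^ numClusters S := by
  have hinj : Function.Injective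
      fun (f : (SimpleGraph.fromEdgeSet (S : Set (Sym2 V))).ConnectedComponent → Fin q) (v : V) =>
        f (SimpleGraph.connectedComponentMk _ v) := by
    intro f g hfg
    funext c
    induction c using SimpleGraph.ConnectedComponent.ind with
    | h v => exact congrFun hfg v
  simp_rw [prod_edgeDelta_eq_ite]
  rw [Finset.sum_boole, ← Fintype.card_subtype, ← Nat.card_eq_fintype_card]
  have hcard := Nat.card_range_of_injective hinj
  rw [Nat.card_fun, Nat.card_fin] at hcard
  exact_mod_cast hcard

/-- If every subset `S ⊆ A` satisfies the cycle-rank bound `ξ(S) ≤ (2/3)(|S|+1)`,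
then for every `0 ≤ k ≤ |A|`,
`Σ_{S ⊆ A, |S| = k} Σ_σ Π_{{i,j} ∈ S} δ_{σ(i),σ(j)} ≤ binom(|A|,k) q^{|V| − k/3 + 2/3}`. -/
theorem sum_delta_cycle_rank_bound
    {V : Type} [Fintype V] [DecidableEq V] (G : SimpleGraph V) [DecidableRel G.Adj]
    (q : ℕ) (hq : 2 ≤ q) (A : Finset (Sym2 V)) (hA : A ⊆ G.edgeFinset)
    (hξ : ∀ S ⊆ A, cycleRank S ≤ (2 / 3 : ℝ) * ((S.card : ℝ) + 1)) :
    ∀ k : ℕ, k ≤ A.card →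
      ∑ S ∈ A.powerset.filter (fun S => S.card = k),
          ∑ σ : V → Fin q, ∏ e ∈ S, edgeDelta σ e ≤
        (A.card.choose k : ℝ) *
          (q : ℝ) ^ ((Fintype.card V : ℝ) - (k : ℝ) / 3 + 2 / 3) := by
  intro k _
  have hq1 : (1 : ℝ) ≤ q := by exact_mod_cast (by omega : 1 ≤ q)
  have hterm : ∀ S ∈ A.powerset.filter (fun S => S.card = k),
      ∑ σ : V → Fin q, ∏ e ∈ S, edgeDelta σ e ≤
        (q : ℝ) ^ ((Fintype.card V : ℝ) - (k : ℝ) / 3 + 2 / 3) := by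
    intro S hS
    obtain ⟨hSA, rfl⟩ := Finset.mem_filter.1 hS
    have hrank := hξ S (Finset.mem_powerset.1 hSA)
    unfold cycleRank at hrank
    rw [sum_prod_edgeDelta, ← Real.rpow_natCast]
    exact Real.rpow_le_rpow_of_exponent_le hq1 (by linarith)
  refine (Finset.sum_le_card_nsmul _ _ _ hterm).trans_eq ?_
  rw [← Finset.powersetCard_eq_filter, Finset.card_powersetCard, nsmul_eq_mul]
end

section
/- For every real μ > ln 2: (i) for every integer N ≥ 1 the sum defining the N-strip pure causal-triangulation partition function Z_N(μ) converges (Z_N(μ) < ∞), and (ii) lim_{N→∞} (1/N)·ln Z_N(μ) = ln Λ(μ). -/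
open scoped ENNReal

/-- Cyclic successor in `Fin N`. -/
def cycSucc {N : ℕ} (i : Fin N) : Fin N :=
  ⟨((i : ℕ) + 1) % N, Nat.mod_lt _ i.pos⟩

/-- The `N`-strip partition function of pure causal triangulations with periodic
spatial boundary condition, given by the transfer-matrix formula
`Z_N(μ) = Σ_{(n_0,…,n_{N−1}) ∈ {1,2,…}^N} Π_i binom(n_i + n_{i+1} − 1, n_i − 1)
  e^{−μ(n_i + n_{i+1})}`, indices cyclic, the sum taken in `[0,∞]`. -/
noncomputable def ctZ (μ : ℝ) (N : ℕ) : ℝ≥0∞ :=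
  ∑' n : Fin N → ℕ+, ∏ i : Fin N,
    ((Nat.choose ((n i : ℕ) + (n (cycSucc i) : ℕ) - 1) ((n i : ℕ) - 1) : ℝ≥0∞) *
      ENNReal.ofReal (Real.exp (-μ * (((n i : ℕ) : ℝ) + ((n (cycSucc i) : ℕ) : ℝ)))))

/-- `Λ(μ) = ((1 − √(1 − 4 e^{−2μ})) / (2 e^{−μ}))²`. -/
noncomputable def Lam (μ : ℝ) : ℝ :=
  ((1 - Real.sqrt (1 - 4 * Real.exp (-2 * μ))) / (2 * Real.exp (-μ))) ^ 2

/-- The Möbius map whose iterates generate the powers of the transfer matrix. -/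
noncomputable def stripMap (g x : ℝ) : ℝ := g / (1 - g * x)

/-- The transfer matrix as a function of the fugacity `g = e^{-μ}`. -/
noncomputable def stripKernel (g : ℝ) (n m : ℕ+) : ℝ :=
  (Nat.choose ((n : ℕ) + (m : ℕ) - 1) ((n : ℕ) - 1) : ℝ) * g ^ ((n : ℕ) + (m : ℕ))

/-- The operator with kernel `K`, acting on `[0, ∞]`-valued functions. -/
noncomputable def transfer (K : ℕ+ → ℕ+ → ℝ≥0∞) (f : ℕ+ → ℝ≥0∞) (n : ℕ+) : ℝ≥0∞ :=
  ∑' m, K n m * f m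

lemma transfer_mono (K : ℕ+ → ℕ+ → ℝ≥0∞) : Monotone (transfer K) := fun _ _ h _ =>
  ENNReal.tsum_le_tsum fun m => by gcongr; exact h m

lemma transfer_const_mul (K : ℕ+ → ℕ+ → ℝ≥0∞) (c : ℝ≥0∞) (f : ℕ+ → ℝ≥0∞) :
    transfer K (fun m => c * f m) = fun n => c * transfer K f n := by
  funext n
  simp only [transfer, ← ENNReal.tsum_mul_left]
  exact tsum_congr fun m => by ring

lemma transfer_single (K : ℕ+ → ℕ+ → ℝ≥0∞) (k : ℕ+) :
    transfer K (Pi.single k 1) = fun m => K m k := by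
  funext m
  rw [transfer, tsum_eq_single k fun j hj => by simp [hj]]
  simp

lemma tsum_fin_cons (M : ℕ) (F : (Fin (M + 1) → ℕ+) → ℝ≥0∞) :
    ∑' n, F n = ∑' (k : ℕ+) (n : Fin M → ℕ+), F (Fin.cons k n) := by
  rw [← (Fin.consEquiv fun _ : Fin (M + 1) => ℕ+).tsum_eq, ENNReal.tsum_prod']
  rfl

lemma tsum_path_eq_iterate_transfer (K : ℕ+ → ℕ+ → ℝ≥0∞) (f : ℕ+ → ℝ≥0∞) (M : ℕ) (k : ℕ+) :
    ∑' n : Fin M → ℕ+, (∏ i : Fin M, K ((Fin.cons k n : Fin (M + 1) → ℕ+) i.castSucc) (n i)) *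
      f ((Fin.cons k n : Fin (M + 1) → ℕ+) (Fin.last M)) = (transfer K)^[M] f k := by
  induction M generalizing k with
  | zero => simp
  | succ M ih =>
    rw [tsum_fin_cons, Function.iterate_succ_apply', transfer]
    refine tsum_congr fun m => ?_
    rw [← ih m, ← ENNReal.tsum_mul_left]
    refine tsum_congr fun n => ?_
    rw [Fin.prod_univ_succ]
    simp only [Fin.castSucc_zero, Fin.cons_zero, Fin.cons_succ, ← Fin.succ_castSucc,
      ← Fin.succ_last]
    ring

lemma cycSucc_castSucc {M : ℕ} (i : Fin M) : cycSucc i.castSucc = i.succ := by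
  ext
  simp [cycSucc, Nat.mod_eq_of_lt]

lemma cycSucc_last (M : ℕ) : cycSucc (Fin.last M) = 0 := by
  ext
  simp [cycSucc]

lemma tsum_cyclic_eq_trace (K : ℕ+ → ℕ+ → ℝ≥0∞) (N : ℕ) (hN : 1 ≤ N) :
    ∑' n : Fin N → ℕ+, ∏ i, K (n i) (n (cycSucc i)) =
      ∑' k, (transfer K)^[N] (Pi.single k 1) k := by
  obtain ⟨M, rfl⟩ : ∃ M, N = M + 1 := ⟨N - 1, by omega⟩
  rw [tsum_fin_cons]
  refine tsum_congr fun k => ?_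
  rw [Function.iterate_succ_apply, transfer_single, ← tsum_path_eq_iterate_transfer]
  refine tsum_congr fun n => ?_
  rw [Fin.prod_univ_castSucc]
  simp only [cycSucc_castSucc, cycSucc_last, Fin.cons_succ, Fin.cons_zero]

lemma ctZ_eq_trace (μ : ℝ) (N : ℕ) (hN : 1 ≤ N) :
    ctZ μ N = ∑' k, (transfer fun n m =>
      ENNReal.ofReal (stripKernel (Real.exp (-μ)) n m))^[N] (Pi.single k 1) k := by
  rw [← tsum_cyclic_eq_trace _ N hN, ctZ]
  refine tsum_congr fun n => Finset.prod_congr rfl fun i _ => ?_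
  rw [stripKernel, ENNReal.ofReal_mul (by positivity), ENNReal.ofReal_natCast,
    ← Real.exp_nat_mul]
  congr 3
  push_cast
  ring

section

variable {g : ℝ}

lemma ratio_lt_one (hg0 : 0 < g) (hg1 : g < 1 / 2) : g / (1 - g) < 1 := by
  rw [div_lt_one] <;> linarith

lemma one_sub_mul_pos (hg0 : 0 < g) (hg1 : g < 1 / 2) {x : ℝ} (hx : x ∈ Set.Icc (0 : ℝ) 1) :
    0 < 1 - g * x := by
  nlinarith [hx.1, hx.2]

lemma stripMap_pos (hg0 : 0 < g) (hg1 : g < 1 / 2) {x : ℝ} (hx : x ∈ Set.Icc (0 : ℝ) 1) :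
    0 < stripMap g x :=
  div_pos hg0 (one_sub_mul_pos hg0 hg1 hx)

lemma stripMap_le_ratio (hg0 : 0 < g) (hg1 : g < 1 / 2) {x : ℝ} (hx : x ∈ Set.Icc (0 : ℝ) 1) :
    stripMap g x ≤ g / (1 - g) := by
  have := hx.2
  rw [stripMap]
  gcongr
  · linarith
  · nlinarith

lemma stripMap_mem (hg0 : 0 < g) (hg1 : g < 1 / 2) {x : ℝ} (hx : x ∈ Set.Icc (0 : ℝ) 1) :
    stripMap g x ∈ Set.Icc (0 : ℝ) 1 :=
  ⟨(stripMap_pos hg0 hg1 hx).le,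
    (stripMap_le_ratio hg0 hg1 hx).trans (ratio_lt_one hg0 hg1).le⟩

lemma iterate_mem (hg0 : 0 < g) (hg1 : g < 1 / 2) {x : ℝ} (hx : x ∈ Set.Icc (0 : ℝ) 1) (i : ℕ) :
    (stripMap g)^[i] x ∈ Set.Icc (0 : ℝ) 1 := by
  induction i with
  | zero => exact hx
  | succ i ih =>
    rw [Function.iterate_succ_apply']
    exact stripMap_mem hg0 hg1 ih

lemma stripMap_sub_stripMap (hg0 : 0 < g) (hg1 : g < 1 / 2) {a b : ℝ}
    (ha : a ∈ Set.Icc (0 : ℝ) 1) (hb : b ∈ Set.Icc (0 : ℝ) 1) :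
    stripMap g a - stripMap g b = stripMap g a * stripMap g b * (a - b) := by
  have h1 := (one_sub_mul_pos hg0 hg1 ha).ne'
  have h2 := (one_sub_mul_pos hg0 hg1 hb).ne'
  rw [stripMap, stripMap]
  field_simp
  ring

lemma iterate_sub_iterate (hg0 : 0 < g) (hg1 : g < 1 / 2) {a b : ℝ}
    (ha : a ∈ Set.Icc (0 : ℝ) 1) (hb : b ∈ Set.Icc (0 : ℝ) 1) (N : ℕ) :
    (stripMap g)^[N] a - (stripMap g)^[N] b =
      (∏ i ∈ Finset.range N, (stripMap g ((stripMap g)^[i] b) * stripMap g ((stripMap g)^[i] a))) *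
        (a - b) := by
  induction N with
  | zero => simp
  | succ N ih =>
    rw [Function.iterate_succ_apply', Function.iterate_succ_apply',
      stripMap_sub_stripMap hg0 hg1 (iterate_mem hg0 hg1 ha N) (iterate_mem hg0 hg1 hb N), ih,
      Finset.prod_range_succ]
    ring

lemma exists_fixed_point (hg0 : 0 < g) (hg1 : g < 1 / 2) :
    ∃ s, s = (1 - Real.sqrt (1 - 4 * g ^ 2)) / (2 * g) ∧ 0 < s ∧ s < 1 ∧ stripMap g s = s := by
  have hd : 0 ≤ 1 - 4 * g ^ 2 := by nlinarith
  have hsq := Real.sq_sqrt hd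
  have hr := Real.sqrt_nonneg (1 - 4 * g ^ 2)
  set r := Real.sqrt (1 - 4 * g ^ 2)
  have hr1 : r < 1 := by nlinarith
  have hr2 : 1 - 2 * g < r := by nlinarith
  refine ⟨_, rfl, by apply div_pos <;> linarith, by rw [div_lt_one] <;> linarith, ?_⟩
  have h : 1 - g * ((1 - r) / (2 * g)) = (1 + r) / 2 := by
    field_simp
    ring
  rw [stripMap, h, div_eq_div_iff (by linarith) (by linarith)]
  nlinarith

lemma tendsto_log_iterate (hg0 : 0 < g) (hg1 : g < 1 / 2) {s : ℝ} (hs0 : 0 < s) (hs1 : s < 1)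
    (hfix : stripMap g s = s) {x : ℝ} (hx : x ∈ Set.Icc (0 : ℝ) 1) :
    Filter.Tendsto (fun i => Real.log (stripMap g ((stripMap g)^[i] x)))
      Filter.atTop (nhds (Real.log s)) := by
  refine Filter.Tendsto.log ?_ hs0.ne'
  have hs : s ∈ Set.Icc (0 : ℝ) 1 := ⟨hs0.le, hs1.le⟩
  have hcontr : ∀ y ∈ Set.Icc (0 : ℝ) 1, |stripMap g y - s| ≤ s * |y - s| := by
    intro y hy
    have h := stripMap_sub_stripMap hg0 hg1 hy hs
    have hy' := stripMap_mem hg0 hg1 hy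
    rw [hfix] at h
    rw [h, abs_mul, abs_of_nonneg (mul_nonneg hy'.1 hs0.le)]
    gcongr
    nlinarith [hy'.2]
  have hbound : ∀ i, |(stripMap g)^[i] x - s| ≤ s ^ i * |x - s| := by
    intro i
    induction i with
    | zero => simp
    | succ i ih =>
      rw [Function.iterate_succ_apply']
      calc _ ≤ s * |(stripMap g)^[i] x - s| := hcontr _ (iterate_mem hg0 hg1 hx i)
        _ ≤ s * (s ^ i * |x - s|) := by gcongr
        _ = _ := by ring
  have hlim : Filter.Tendsto (fun i => (stripMap g)^[i] x) Filter.atTop (nhds s) := by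
    rw [tendsto_iff_dist_tendsto_zero]
    refine squeeze_zero (fun _ => dist_nonneg) hbound ?_
    simpa using (tendsto_pow_atTop_nhds_zero_of_lt_one hs0.le hs1).mul_const |x - s|
  have := (Filter.tendsto_add_atTop_iff_nat 1).2 hlim
  simpa only [Function.iterate_succ_apply'] using this

lemma stripKernel_nonneg (hg0 : 0 < g) (n m : ℕ+) : 0 ≤ stripKernel g n m := by
  unfold stripKernel
  positivity

lemma hasSum_pnat_of_hasSum_nat {f : ℕ+ → ℝ} {F : ℕ → ℝ} {a b : ℝ} (hF : HasSum F b)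
    (hf : ∀ j : ℕ, f j.succPNat = F j) (hab : b = a) : HasSum f a := by
  rw [← Equiv.pnatEquivNat.symm.hasSum_iff, ← hab]
  rwa [← funext hf] at hF

lemma hasSum_stripKernel_mul_pow (hg0 : 0 < g) (hg1 : g < 1 / 2) {x : ℝ}
    (hx : x ∈ Set.Icc (0 : ℝ) 1) (n : ℕ+) :
    HasSum (fun m : ℕ+ => stripKernel g n m * x ^ (m : ℕ))
      (stripMap g x ^ (n : ℕ) - g ^ (n : ℕ)) := by
  obtain ⟨k, rfl⟩ : ∃ k : ℕ, n = k.succPNat := ⟨n.natPred, by simp⟩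
  have hpos := one_sub_mul_pos hg0 hg1 hx
  have hlt : ‖g * x‖ < 1 := by
    rw [Real.norm_of_nonneg (mul_nonneg hg0.le hx.1)]
    linarith
  have h0 := hasSum_choose_mul_geometric_of_norm_lt_one k hlt
  rw [← hasSum_nat_add_iff' 1, Finset.sum_range_one] at h0
  have h := h0.mul_left (g ^ (k + 1))
  refine hasSum_pnat_of_hasSum_nat h (fun j => ?_) ?_
  · simp only [stripKernel, Nat.succPNat_coe, Nat.succ_eq_add_one]
    rw [show k + 1 + (j + 1) - 1 = j + 1 + k by omega, Nat.add_sub_cancel]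
    ring
  · simp only [Nat.succPNat_coe, Nat.succ_eq_add_one, stripMap, div_pow, Nat.zero_add,
      Nat.choose_self, Nat.cast_one, pow_zero]
    ring

lemma hasSum_stripKernel_mul_deriv (hg0 : 0 < g) (hg1 : g < 1 / 2) {x : ℝ}
    (hx : x ∈ Set.Icc (0 : ℝ) 1) (n : ℕ+) :
    HasSum (fun m : ℕ+ => stripKernel g n m * ((m : ℕ) * x ^ ((m : ℕ) - 1)))
      (stripMap g x ^ 2 * ((n : ℕ) * stripMap g x ^ ((n : ℕ) - 1))) := by
  obtain ⟨k, rfl⟩ : ∃ k : ℕ, n = k.succPNat := ⟨n.natPred, by simp⟩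
  have hpos := one_sub_mul_pos hg0 hg1 hx
  have hlt : ‖g * x‖ < 1 := by
    rw [Real.norm_of_nonneg (mul_nonneg hg0.le hx.1)]
    linarith
  have h := (hasSum_choose_mul_geometric_of_norm_lt_one (k + 1) hlt).mul_left
    ((k + 1) * g ^ (k + 2))
  refine hasSum_pnat_of_hasSum_nat h (fun j => ?_) ?_
  · simp only [stripKernel, Nat.succPNat_coe, Nat.succ_eq_add_one]
    rw [show k + 1 + (j + 1) - 1 = j + (k + 1) by omega, Nat.add_sub_cancel, Nat.add_sub_cancel]
    have hc : ((j + (k + 1)).choose (k + 1) : ℝ) * (k + 1) = (j + (k + 1)).choose k * (j + 1) := by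
      have := Nat.choose_succ_right_eq (j + (k + 1)) k
      rw [show j + (k + 1) - k = j + 1 by omega] at this
      exact_mod_cast this
    push_cast
    linear_combination (-(g ^ (k + 2 + j) * x ^ j)) * hc
  · simp only [Nat.succPNat_coe, Nat.succ_eq_add_one, Nat.add_sub_cancel, stripMap, div_pow]
    push_cast
    field_simp
    ring

lemma transfer_ofReal (hg0 : 0 < g) {f : ℕ+ → ℝ} (hf : ∀ m, 0 ≤ f m) {n : ℕ+} {a : ℝ}
    (h : HasSum (fun m => stripKernel g n m * f m) a) :
    transfer (fun n m => ENNReal.ofReal (stripKernel g n m)) (fun m => ENNReal.ofReal (f m)) n =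
      ENNReal.ofReal a := by
  rw [← h.tsum_eq, ENNReal.ofReal_tsum_of_nonneg
    (fun m => mul_nonneg (stripKernel_nonneg hg0 n m) (hf m)) h.summable, transfer]
  exact tsum_congr fun m => (ENNReal.ofReal_mul (stripKernel_nonneg hg0 n m)).symm

lemma iterate_transfer_pow_sub (hg0 : 0 < g) (hg1 : g < 1 / 2) {a b : ℝ}
    (ha : a ∈ Set.Icc (0 : ℝ) 1) (hb : b ∈ Set.Icc (0 : ℝ) 1) (hab : b ≤ a) (N : ℕ) :
    (transfer fun n m => ENNReal.ofReal (stripKernel g n m))^[N]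
        (fun m : ℕ+ => ENNReal.ofReal (a ^ (m : ℕ) - b ^ (m : ℕ))) =
      fun n : ℕ+ => ENNReal.ofReal
        ((stripMap g)^[N] a ^ (n : ℕ) - (stripMap g)^[N] b ^ (n : ℕ)) := by
  induction N with
  | zero => rfl
  | succ N ih =>
    have ha' := iterate_mem hg0 hg1 ha N
    have hb' := iterate_mem hg0 hg1 hb N
    have hle : (stripMap g)^[N] b ≤ (stripMap g)^[N] a := by
      rw [← sub_nonneg, iterate_sub_iterate hg0 hg1 ha hb]
      exact mul_nonneg (Finset.prod_nonneg fun i _ => mul_nonneg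
        (stripMap_pos hg0 hg1 (iterate_mem hg0 hg1 hb i)).le
        (stripMap_pos hg0 hg1 (iterate_mem hg0 hg1 ha i)).le) (sub_nonneg.2 hab)
    funext n
    rw [Function.iterate_succ_apply', ih, Function.iterate_succ_apply',
      Function.iterate_succ_apply']
    refine transfer_ofReal hg0
      (fun m => sub_nonneg.2 (pow_le_pow_left₀ hb'.1 hle _)) ?_
    have h := (hasSum_stripKernel_mul_pow hg0 hg1 ha' n).sub
      (hasSum_stripKernel_mul_pow hg0 hg1 hb' n)
    rw [sub_sub_sub_cancel_right] at h
    simp only [mul_sub]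
    exact h

lemma iterate_transfer_deriv (hg0 : 0 < g) (hg1 : g < 1 / 2) {x : ℝ}
    (hx : x ∈ Set.Icc (0 : ℝ) 1) (N : ℕ) :
    (transfer fun n m => ENNReal.ofReal (stripKernel g n m))^[N]
        (fun m : ℕ+ => ENNReal.ofReal ((m : ℕ) * x ^ ((m : ℕ) - 1))) =
      fun n : ℕ+ => ENNReal.ofReal (∏ i ∈ Finset.range N, stripMap g ((stripMap g)^[i] x) ^ 2) *
        ENNReal.ofReal ((n : ℕ) * (stripMap g)^[N] x ^ ((n : ℕ) - 1)) := by
  induction N with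
  | zero => simp
  | succ N ih =>
    have hx' := iterate_mem hg0 hg1 hx N
    rw [Function.iterate_succ_apply', ih, transfer_const_mul]
    funext n
    rw [transfer_ofReal hg0 (fun m => mul_nonneg (Nat.cast_nonneg _) (pow_nonneg hx'.1 _))
      (hasSum_stripKernel_mul_deriv hg0 hg1 hx' n), Finset.prod_range_succ,
      Function.iterate_succ_apply', ENNReal.ofReal_mul (sq_nonneg _), ← mul_assoc,
      ← ENNReal.ofReal_mul (Finset.prod_nonneg fun i _ => sq_nonneg _)]

end

lemma prod_le_ctZ (μ : ℝ) (hg0 : 0 < Real.exp (-μ)) (hg1 : Real.exp (-μ) < 1 / 2) (N : ℕ)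
    (hN : 1 ≤ N) :
    ENNReal.ofReal (∏ i ∈ Finset.range N,
      stripMap (Real.exp (-μ)) ((stripMap (Real.exp (-μ)))^[i] 0) ^ 2) ≤ ctZ μ N := by
  have hsingle : (Pi.single 1 1 : ℕ+ → ℝ≥0∞) =
      fun m : ℕ+ => ENNReal.ofReal ((m : ℕ) * (0 : ℝ) ^ ((m : ℕ) - 1)) := by
    funext m
    by_cases hm : m = 1
    · simp [hm]
    · have hm' : (m : ℕ) - 1 ≠ 0 := by
        have := m.pos
        have : (m : ℕ) ≠ 1 := fun h => hm (PNat.coe_eq_one_iff.1 h)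
        omega
      simp [hm, hm']
  rw [ctZ_eq_trace μ N hN]
  refine le_trans ?_ (ENNReal.le_tsum 1)
  rw [hsingle, iterate_transfer_deriv hg0 hg1 (by simp)]
  simp

lemma pow_sub_pow_le_mul {a b r : ℝ} (hb : 0 ≤ b) (hab : b ≤ a) (har : a ≤ r) (n : ℕ) :
    a ^ (n + 1) - b ^ (n + 1) ≤ (a - b) * ((n + 1) * r ^ n) := by
  induction n with
  | zero => simp
  | succ n ih =>
    have h1 : b ^ (n + 1) ≤ r ^ (n + 1) := pow_le_pow_left₀ hb (hab.trans har) _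
    calc a ^ (n + 1 + 1) - b ^ (n + 1 + 1)
        = a * (a ^ (n + 1) - b ^ (n + 1)) + (a - b) * b ^ (n + 1) := by ring
      _ ≤ r * ((a - b) * ((n + 1) * r ^ n)) + (a - b) * r ^ (n + 1) := by
        have h2 : 0 ≤ a ^ (n + 1) - b ^ (n + 1) := sub_nonneg.2 (pow_le_pow_left₀ hb hab _)
        have h3 : 0 ≤ r := by linarith
        have h4 : 0 ≤ a - b := by linarith
        gcongr
      _ = _ := by push_cast; ring

lemma hasSum_succ_mul_pow {r : ℝ} (hr0 : 0 ≤ r) (hr1 : r < 1) :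
    HasSum (fun j : ℕ => ((j : ℝ) + 1) * r ^ j) (1 / (1 - r) ^ 2) := by
  have h := hasSum_choose_mul_geometric_of_norm_lt_one (𝕜 := ℝ) 1
    (by rwa [Real.norm_of_nonneg hr0])
  simpa using h

lemma ctZ_le_prod (μ : ℝ) (hg0 : 0 < Real.exp (-μ)) (hg1 : Real.exp (-μ) < 1 / 2) (N : ℕ)
    (hN : 1 ≤ N) :
    ctZ μ N ≤ ENNReal.ofReal ((∏ i ∈ Finset.range N,
      (stripMap (Real.exp (-μ)) ((stripMap (Real.exp (-μ)))^[i] 0) *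
        stripMap (Real.exp (-μ)) ((stripMap (Real.exp (-μ)))^[i] 1))) *
      (1 / (1 - Real.exp (-μ) / (1 - Real.exp (-μ))) ^ 2)) := by
  rw [ctZ_eq_trace μ N hN]
  set g := Real.exp (-μ)
  have h0 : (0 : ℝ) ∈ Set.Icc (0 : ℝ) 1 := by simp
  have h1 : (1 : ℝ) ∈ Set.Icc (0 : ℝ) 1 := by simp
  have hsub := iterate_sub_iterate hg0 hg1 h1 h0 N
  rw [sub_zero, mul_one] at hsub
  rw [← hsub]
  set a := (stripMap g)^[N] 1 with ha
  set b := (stripMap g)^[N] 0 with hb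
  have hb0 : 0 ≤ b := (iterate_mem hg0 hg1 h0 N).1
  have hab : b ≤ a := by
    rw [← sub_nonneg, hsub]
    exact Finset.prod_nonneg fun i _ => mul_nonneg
      (stripMap_pos hg0 hg1 (iterate_mem hg0 hg1 h0 i)).le
      (stripMap_pos hg0 hg1 (iterate_mem hg0 hg1 h1 i)).le
  have har : a ≤ g / (1 - g) := by
    obtain ⟨M, rfl⟩ : ∃ M, N = M + 1 := ⟨N - 1, by omega⟩
    rw [ha, Function.iterate_succ_apply']
    exact stripMap_le_ratio hg0 hg1 (iterate_mem hg0 hg1 h1 M)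
  have hr0 : 0 ≤ g / (1 - g) := (hb0.trans hab).trans har
  have hS := (hasSum_succ_mul_pow hr0 (ratio_lt_one hg0 hg1)).mul_left (a - b)
  rw [← hS.tsum_eq, ENNReal.ofReal_tsum_of_nonneg
    (fun j => mul_nonneg (sub_nonneg.2 hab) (by positivity)) hS.summable,
    ← Equiv.pnatEquivNat.symm.tsum_eq]
  refine ENNReal.tsum_le_tsum fun j => ?_
  have hle : (Pi.single (Equiv.pnatEquivNat.symm j) 1 : ℕ+ → ℝ≥0∞) ≤
      fun m : ℕ+ => ENNReal.ofReal ((1 : ℝ) ^ (m : ℕ) - 0 ^ (m : ℕ)) := by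
    intro m
    by_cases hm : m = Equiv.pnatEquivNat.symm j
    · subst hm
      simp
    · rw [Pi.single_eq_of_ne hm]
      exact zero_le
  refine ((transfer_mono _).iterate N hle _).trans ?_
  rw [iterate_transfer_pow_sub hg0 hg1 h1 h0 zero_le_one]
  exact ENNReal.ofReal_le_ofReal (pow_sub_pow_le_mul hb0 hab har j)

/-- For `μ > ln 2` the `N`-strip pure CT partition function is finite for every
`N ≥ 1`, and `(1/N) ln Z_N(μ) → ln Λ(μ)` as `N → ∞`. -/
theorem ct_free_energy (μ : ℝ) (hμ : Real.log 2 < μ) :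
    (∀ N : ℕ, 1 ≤ N → ctZ μ N < ⊤) ∧
    Filter.Tendsto (fun N : ℕ => (1 / (N : ℝ)) * Real.log ((ctZ μ N).toReal))
      Filter.atTop (nhds (Real.log (Lam μ))) := by
  set g := Real.exp (-μ) with hg
  have hg0 : 0 < g := Real.exp_pos _
  have hg1 : g < 1 / 2 := by
    rw [hg, ← Real.exp_log (show (0 : ℝ) < 1 / 2 by norm_num), Real.exp_lt_exp,
      one_div, Real.log_inv]
    linarith
  have hlow := prod_le_ctZ μ hg0 hg1
  have hupp := ctZ_le_prod μ hg0 hg1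
  rw [← hg] at hlow hupp
  refine ⟨fun N hN => (hupp N hN).trans_lt ENNReal.ofReal_lt_top, ?_⟩
  obtain ⟨s, hs, hs0, hs1, hfix⟩ := exists_fixed_point hg0 hg1
  have hLam : Lam μ = s ^ 2 := by
    rw [hs, Lam, ← hg, hg, ← Real.exp_nat_mul]
    congr 6
    push_cast
    ring_nf
  have h0 : (0 : ℝ) ∈ Set.Icc (0 : ℝ) 1 := by simp
  have h1 : (1 : ℝ) ∈ Set.Icc (0 : ℝ) 1 := by simp
  have hp := fun i => stripMap_pos hg0 hg1 (iterate_mem hg0 hg1 h0 i)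
  have hq := fun i => stripMap_pos hg0 hg1 (iterate_mem hg0 hg1 h1 i)
  have lp := tendsto_log_iterate hg0 hg1 hs0 hs1 hfix h0
  have lq := tendsto_log_iterate hg0 hg1 hs0 hs1 hfix h1
  have hC : 0 < 1 / (1 - g / (1 - g)) ^ 2 := by
    have := ratio_lt_one hg0 hg1
    have : 0 < 1 - g / (1 - g) := by linarith
    positivity
  have clow := (lp.add lp).cesaro
  have cupp := ((lp.add lq).cesaro).add
    ((tendsto_inv_atTop_nhds_zero_nat (𝕜 := ℝ)).mul_const (Real.log (1 / (1 - g / (1 - g)) ^ 2)))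
  have hlim : Real.log (Lam μ) = Real.log s + Real.log s := by
    rw [hLam, Real.log_pow]
    push_cast
    ring
  rw [zero_mul, add_zero] at cupp
  rw [hlim]
  refine tendsto_of_tendsto_of_tendsto_of_le_of_le' clow cupp ?_ ?_
  · filter_upwards [Filter.eventually_ge_atTop 1] with N hN
    have hfin : ctZ μ N ≠ ⊤ := ((hupp N hN).trans_lt ENNReal.ofReal_lt_top).ne
    have key := (ENNReal.ofReal_le_iff_le_toReal hfin).1 (hlow N hN)
    have hpos : 0 < ∏ i ∈ Finset.range N, stripMap g ((stripMap g)^[i] 0) ^ 2 :=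
      Finset.prod_pos fun i _ => pow_pos (hp i) 2
    have := Real.log_le_log hpos key
    rw [Real.log_prod fun i _ => (pow_pos (hp i) 2).ne'] at this
    rw [one_div]
    refine mul_le_mul_of_nonneg_left (le_trans (le_of_eq ?_) this) (by positivity)
    refine Finset.sum_congr rfl fun i _ => ?_
    rw [Real.log_pow]
    push_cast
    ring
  · filter_upwards [Filter.eventually_ge_atTop 1] with N hN
    have hfin : ctZ μ N ≠ ⊤ := ((hupp N hN).trans_lt ENNReal.ofReal_lt_top).ne
    have hpos : 0 < ∏ i ∈ Finset.range N, stripMap g ((stripMap g)^[i] 0) ^ 2 :=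
      Finset.prod_pos fun i _ => pow_pos (hp i) 2
    have hZ : 0 < (ctZ μ N).toReal :=
      hpos.trans_le ((ENNReal.ofReal_le_iff_le_toReal hfin).1 (hlow N hN))
    have hprod : 0 < ∏ i ∈ Finset.range N,
        (stripMap g ((stripMap g)^[i] 0) * stripMap g ((stripMap g)^[i] 1)) :=
      Finset.prod_pos fun i _ => mul_pos (hp i) (hq i)
    have key := ENNReal.toReal_le_of_le_ofReal (by positivity) (hupp N hN)
    have := Real.log_le_log hZ key
    rw [Real.log_mul hprod.ne' hC.ne',
      Real.log_prod fun i _ => (mul_pos (hp i) (hq i)).ne'] at this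
    rw [one_div, ← mul_add]
    refine mul_le_mul_of_nonneg_left (le_trans this (le_of_eq ?_)) (by positivity)
    congr 1
    exact Finset.sum_congr rfl fun i _ => Real.log_mul (hp i).ne' (hq i).ne'
end

section
/- For every real μ < ln 2 there exists N_0 ∈ ℕ such that for all integers N > N_0 the N-strip pure causal-triangulation partition function diverges: Z_N(μ) = +∞. -/
open scoped ENNReal

theorem four_pow_succ_le_mul_choose (m : ℕ) :
    4 ^ (m + 1) ≤ 4 * (m + 1) * (2 * m + 1).choose m := by
  have h := Nat.four_pow_le_two_mul_self_mul_centralBinom (m + 1) m.succ_pos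
  have hc : Nat.centralBinom (m + 1) = 2 * (2 * m + 1).choose m := by
    rw [Nat.centralBinom_eq_two_mul_choose, show 2 * (m + 1) = 2 * m + 1 + 1 by ring,
      Nat.choose_succ_succ, Nat.choose_symm_half, ← two_mul]
  rw [hc] at h
  linarith

/-- The transfer-matrix diagonal is unbounded for `μ < ln 2`. -/
theorem exists_le_choose_mul_exp {μ : ℝ} (hμ : μ < Real.log 2) {K : ℝ} (hK : 0 < K) :
    ∃ m : ℕ, K ≤ ((2 * m + 1).choose m : ℝ) * Real.exp (-μ * (2 * ((m : ℝ) + 1))) := by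
  have hr : 1 < 4 * Real.exp (-μ * 2) := by
    have h4 : (4 : ℝ) = Real.exp (2 * Real.log 2) := by
      rw [two_mul, Real.exp_add, Real.exp_log two_pos]; norm_num
    rw [h4, ← Real.exp_add, Real.one_lt_exp_iff]
    linarith
  have ht := (tendsto_pow_const_div_const_pow_of_one_lt 1 hr).comp (Filter.tendsto_add_atTop_nat 1)
  obtain ⟨m, hm⟩ := (ht.eventually_lt_const (show (0 : ℝ) < 1 / (4 * K) by positivity)).exists
  refine ⟨m, ?_⟩
  have hexp : Real.exp (-μ * (2 * ((m : ℝ) + 1))) = Real.exp (-μ * 2) ^ (m + 1) := by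
    rw [← Real.exp_nat_mul]; push_cast; ring_nf
  have hc : (4 : ℝ) ^ (m + 1) ≤ 4 * (m + 1) * (2 * m + 1).choose m := by
    exact_mod_cast four_pow_succ_le_mul_choose m
  have he : 0 < Real.exp (-μ * 2) ^ (m + 1) := by positivity
  simp only [Function.comp_apply, pow_one, mul_pow, Nat.cast_add, Nat.cast_one] at hm
  rw [div_lt_div_iff₀ (by positivity) (by positivity)] at hm
  rw [hexp]
  have hmul := mul_le_mul_of_nonneg_right hc he.le
  have hm' : (0 : ℝ) < 4 * (m + 1) := by positivity
  refine le_of_mul_le_mul_left ?_ hm'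
  linarith

theorem pow_le_ctZ (μ : ℝ) (N m : ℕ) :
    (((2 * m + 1).choose m : ℝ≥0∞) *
      ENNReal.ofReal (Real.exp (-μ * (2 * ((m : ℝ) + 1))))) ^ N ≤ ctZ μ N := by
  refine le_of_eq_of_le ?_ (ENNReal.le_tsum fun _ : Fin N => m.succPNat)
  have hidx : m + 1 + (m + 1) - 1 = 2 * m + 1 := by omega
  simp [hidx, two_mul]

/-- For every `μ < ln 2` there exists `N₀` such that `Z_N(μ) = +∞` for all `N > N₀`. -/
theorem ctZ_eventually_eq_top (μ : ℝ) (hμ : μ < Real.log 2) :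
    ∃ N₀ : ℕ, ∀ N : ℕ, N₀ < N → ctZ μ N = ⊤ := by
  refine ⟨0, fun N hN => ENNReal.eq_top_of_forall_nnreal_le fun K => ?_⟩
  obtain ⟨m, hm⟩ := exists_le_choose_mul_exp hμ (K := (K : ℝ) + 1) (by positivity)
  have hle : ((K + 1 : NNReal) : ℝ≥0∞) ≤ ((2 * m + 1).choose m : ℝ≥0∞) *
      ENNReal.ofReal (Real.exp (-μ * (2 * ((m : ℝ) + 1)))) := by
    rw [← ENNReal.ofReal_natCast, ← ENNReal.ofReal_mul (Nat.cast_nonneg _),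
      ← ENNReal.ofReal_coe_nnreal]
    exact ENNReal.ofReal_le_ofReal (by simpa using hm)
  have hone : (1 : ℝ≥0∞) ≤ ((K + 1 : NNReal) : ℝ≥0∞) := by simp
  calc (K : ℝ≥0∞) ≤ ((K + 1 : NNReal) : ℝ≥0∞) := by simp
    _ ≤ _ := hle
    _ ≤ _ := le_self_pow₀ (hone.trans hle) hN.ne'
    _ ≤ ctZ μ N := pow_le_ctZ μ N m
end
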